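/- Let N, m be positive natural numbers, let V be a real N×m matrix with orthonormal columns (VᵀV = I_m), and set P = V Vᵀ. Let y ∈ ℝ^N be a vector with y ≠ 0 and P y ≠ 0, and let S₁, S₂ be natural numbers with 1 ≤ S₁ < S₂. Then ‖(I − ((S₂−1)/S₂) P) y‖₂ < ‖(I − ((S₁−1)/S₁) P) y‖₂, where ‖·‖₂ denotes the Euclidean norm on ℝ^N. (Consequently, the Euclidean norm of the leading local error term (Δt²/2)(I − ((S−1)/S) V Vᵀ)(df/dt) of the S-substep ETD1 Krylov recycling scheme strictly decreases as the number of substeps S increases.) -/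

import Mathlib

open Matrix

/-- The Euclidean norm on `Fin N → ℝ`. -/
noncomputable def euclideanNorm {N : ℕ} (x : Fin N → ℝ) : ℝ :=
  Real.sqrt (∑ i, x i ^ 2)

theorem aux_norm_sq {N : ℕ} (P : Matrix (Fin N) (Fin N) ℝ) (y : Fin N → ℝ)
    (h : y ⬝ᵥ (P *ᵥ y) = (P *ᵥ y) ⬝ᵥ (P *ᵥ y)) (a : ℝ) :
    ∑ i, (((1 : Matrix (Fin N) (Fin N) ℝ) - a • P) *ᵥ y) i ^ 2
      = y ⬝ᵥ y - (1 - (1 - a) ^ 2) * ((P *ᵥ y) ⬝ᵥ (P *ᵥ y)) := by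
  have e : ∑ i, (((1 : Matrix (Fin N) (Fin N) ℝ) - a • P) *ᵥ y) i ^ 2
      = (y - a • (P *ᵥ y)) ⬝ᵥ (y - a • (P *ᵥ y)) := by
    rw [Matrix.sub_mulVec, Matrix.one_mulVec, Matrix.smul_mulVec]
    simp only [dotProduct, sq]
  rw [e]
  simp only [sub_dotProduct, dotProduct_sub, smul_dotProduct, dotProduct_smul, smul_eq_mul]
  rw [dotProduct_comm (P *ᵥ y) y, h]
  ring

theorem substep_error_decreases (N m : ℕ) (hN : 0 < N) (hm : 0 < m)
    (V : Matrix (Fin N) (Fin m) ℝ) (hV : Vᵀ * V = 1)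
    (P : Matrix (Fin N) (Fin N) ℝ) (hP : P = V * Vᵀ)
    (y : Fin N → ℝ) (hy : y ≠ 0) (hPy : P *ᵥ y ≠ 0)
    (S₁ S₂ : ℕ) (hS₁ : 1 ≤ S₁) (hS : S₁ < S₂) :
    euclideanNorm (((1 : Matrix (Fin N) (Fin N) ℝ)
        - (((S₂ : ℝ) - 1) / (S₂ : ℝ)) • P) *ᵥ y)
      < euclideanNorm (((1 : Matrix (Fin N) (Fin N) ℝ)
        - (((S₁ : ℝ) - 1) / (S₁ : ℝ)) • P) *ᵥ y) := by
  have hPP : Pᵀ * P = P := by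
    rw [hP, Matrix.transpose_mul, Matrix.transpose_transpose, Matrix.mul_assoc,
      ← Matrix.mul_assoc Vᵀ V, hV, Matrix.one_mul]
  have h : y ⬝ᵥ (P *ᵥ y) = (P *ᵥ y) ⬝ᵥ (P *ᵥ y) := by
    conv_lhs => rw [← hPP]
    rw [← Matrix.mulVec_mulVec, Matrix.dotProduct_mulVec, Matrix.vecMul_transpose]
  have hq : 0 < (P *ᵥ y) ⬝ᵥ (P *ᵥ y) := by
    refine lt_of_le_of_ne (Finset.sum_nonneg fun i _ => mul_self_nonneg _) ?_
    intro h0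
    exact hPy (dotProduct_self_eq_zero.mp h0.symm)
  have h1 : (0 : ℝ) < S₁ := by exact_mod_cast hS₁
  have h12 : (S₁ : ℝ) < S₂ := by exact_mod_cast hS
  have h2 : (0 : ℝ) < S₂ := h1.trans h12
  have e1 : 1 - ((S₁ : ℝ) - 1) / S₁ = 1 / S₁ := by field_simp; ring
  have e2 : 1 - ((S₂ : ℝ) - 1) / S₂ = 1 / S₂ := by field_simp; ring
  have hlt : (1 / (S₂ : ℝ)) ^ 2 < (1 / (S₁ : ℝ)) ^ 2 :=
    pow_lt_pow_left₀ (one_div_lt_one_div_of_lt h1 h12) (by positivity) two_ne_zero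
  unfold euclideanNorm
  apply Real.sqrt_lt_sqrt (Finset.sum_nonneg fun i _ => sq_nonneg _)
  rw [aux_norm_sq P y h, aux_norm_sq P y h, e1, e2]
  nlinarith [mul_pos (sub_pos.mpr hlt) hq]
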